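/- For each δ ∈ (0, 19991/100000), the Rychkov system ẋ = y − (x⁵ − x³ + δx), ẏ = −x has at least two distinct nonconstant periodic solutions: there exist nonconstant differentiable γ, σ : ℝ → ℝ², periods T₁, T₂ > 0, with γ'(t) = (γ₂(t) − (γ₁(t)⁵ − γ₁(t)³ + δγ₁(t)), −γ₁(t)), σ'(t) = (σ₂(t) − (σ₁(t)⁵ − σ₁(t)³ + δσ₁(t)), −σ₁(t)), γ(t+T₁) = γ(t), σ(t+T₂) = σ(t) for all t, and such that the images of γ and σ are disjoint. -/

import Mathlib

open Set Filter Topology MeasureTheory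
open scoped NNReal

/-- A bounded, globally Lipschitz vector field has a global integral curve through every point. -/
theorem exists_isIntegralCurve_of_bounded {E : Type*} [NormedAddCommGroup E] [NormedSpace ℝ E]
    [CompleteSpace E] {v : ℝ → E → E} {K M : ℝ≥0} (hlip : ∀ t, LipschitzWith K (v t))
    (hcont : ∀ x, Continuous (v · x)) (hbound : ∀ t x, ‖v t x‖ ≤ M) (x₀ : E) :
    ∃ α : ℝ → E, α 0 = x₀ ∧ IsIntegralCurve α v := by
  have hlocal : ∀ n : ℕ, ∃ α : ℝ → E, α 0 = x₀ ∧
      ∀ t ∈ Ioo (-((n : ℝ) + 1)) (n + 1), HasDerivAt α (v t (α t)) t := by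
    intro n
    have hn : (0 : ℝ) ≤ n := n.cast_nonneg
    have hpl : IsPicardLindelof v (tmin := -((n : ℝ) + 1)) (tmax := n + 1)
        ⟨0, by constructor <;> linarith⟩ x₀ (M * (n + 1)) 0 M K :=
      { lipschitzOnWith := fun t _ => (hlip t).lipschitzOnWith
        continuousOn := fun x _ => (hcont x).continuousOn
        norm_le := fun t _ x _ => hbound t x
        mul_max_le := by simp }
    obtain ⟨α, hα0, hα⟩ := hpl.exists_eq_forall_mem_Icc_hasDerivWithinAt₀
    exact ⟨α, hα0, fun t ht => (hα t (Ioo_subset_Icc_self ht)).hasDerivAt (Icc_mem_nhds ht.1 ht.2)⟩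
  choose α hα0 hα using hlocal
  have hagree : ∀ m n : ℕ, m ≤ n → EqOn (α m) (α n) (Ioo (-((m : ℝ) + 1)) (m + 1)) := by
    intro m n hmn
    have hm : (0 : ℝ) ≤ m := m.cast_nonneg
    have hmn' : (m : ℝ) ≤ n := by exact_mod_cast hmn
    refine ODE_solution_unique_of_mem_Ioo (v := v) (K := K) (s := fun _ => univ) (t₀ := 0)
      (fun t _ => (hlip t).lipschitzOnWith) (by constructor <;> linarith)
      (fun t ht => ⟨hα m t ht, trivial⟩)
      (fun t ht => ⟨hα n t ⟨by linarith [ht.1], by linarith [ht.2]⟩, trivial⟩) ?_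
    rw [hα0, hα0]
  have hmem : ∀ t : ℝ, ∀ n : ℕ, |t| ≤ n → t ∈ Ioo (-((n : ℝ) + 1)) (n + 1) := by
    intro t n h
    rw [abs_le] at h
    constructor <;> linarith
  refine ⟨fun t => α ⌈|t|⌉₊ t, hα0 _, fun t => ?_⟩
  have ht := hmem t _ (Nat.le_ceil |t|)
  have heq : (fun s => α ⌈|s|⌉₊ s) =ᶠ[𝓝 t] α ⌈|t|⌉₊ := by
    filter_upwards [isOpen_Ioo.mem_nhds ht] with s hs
    rcases le_total ⌈|s|⌉₊ ⌈|t|⌉₊ with h | h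
    · exact hagree _ _ h (hmem s _ (Nat.le_ceil |s|))
    · exact (hagree _ _ h hs).symm
  exact (hα _ t ht).congr_of_eventuallyEq heq

/-- The time-`τ` map of a flow with a globally Lipschitz vector field is continuous. -/
theorem continuous_flow_map {v : ℝ → ℝ → ℝ} {K : ℝ≥0} (hlip : ∀ t, LipschitzWith K (v t))
    {α : ℝ → ℝ → ℝ} (h0 : ∀ x, α x 0 = x) (hα : ∀ x, IsIntegralCurve (α x) v) {τ : ℝ} (hτ : 0 ≤ τ) :
    Continuous fun x => α x τ := by
  have : LipschitzWith (Real.exp (K * τ)).toNNReal fun x => α x τ := by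
    refine LipschitzWith.of_dist_le_mul fun x y => ?_
    have := dist_le_of_trajectories_ODE hlip (hα x).continuous.continuousOn
      (fun t _ => (hα x t).hasDerivWithinAt) (hα y).continuous.continuousOn
      (fun t _ => (hα y t).hasDerivWithinAt) (le_of_eq (by rw [h0, h0])) τ ⟨hτ, le_rfl⟩
    rwa [sub_zero, mul_comm, ← Real.coe_toNNReal _ (Real.exp_nonneg _)] at this
  exact this.continuous

/-- A positive periodic speed on the line is realised by a motion that advances by one period of
the speed in a fixed time. -/
theorem exists_motion_of_periodic_speed {h : ℝ → ℝ} {P M : ℝ} (hcont : Continuous h)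
    (hpos : ∀ x, 0 < h x) (hle : ∀ x, h x ≤ M) (hper : Function.Periodic h P) (hP : 0 < P) :
    ∃ (φ : ℝ → ℝ) (T : ℝ), 0 < T ∧ (∀ t, HasDerivAt φ (h (φ t)) t) ∧ ∀ t, φ (t + T) = φ t + P := by
  have hinv : Continuous fun x => (h x)⁻¹ := hcont.inv₀ fun x => (hpos x).ne'
  have hM : 0 < M := (hpos 0).trans_le (hle 0)
  set τ : ℝ → ℝ := fun x => ∫ s in (0 : ℝ)..x, (h s)⁻¹ with hτ
  have hderiv : ∀ x, HasDerivAt τ (h x)⁻¹ x := fun x =>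
    intervalIntegral.integral_hasDerivAt_right (hinv.intervalIntegrable _ _)
      (hinv.stronglyMeasurableAtFilter _ _) hinv.continuousAt
  have hmono : StrictMono τ := strictMono_of_hasDerivAt_pos hderiv fun x => inv_pos.2 (hpos x)
  have hcontτ : Continuous τ := continuous_iff_continuousAt.2 fun x => (hderiv x).continuousAt
  have hgrow : Monotone fun x => τ x - M⁻¹ * x := by
    refine monotone_of_hasDerivAt_nonneg (f' := fun x => (h x)⁻¹ - M⁻¹ * 1)
      (fun x => (hderiv x).sub ((hasDerivAt_id x).const_mul _)) fun x => ?_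
    have := inv_anti₀ (hpos x) (hle x)
    simpa using this
  have hτ0 : τ 0 = 0 := by simp [hτ]
  have hsurj : Function.Surjective τ := by
    refine hcontτ.surjective ?_ ?_
    · refine tendsto_atTop_mono' _ ?_ (tendsto_id.const_mul_atTop (inv_pos.2 hM))
      filter_upwards [eventually_ge_atTop 0] with x hx
      have := hgrow hx
      simp only [hτ0] at this
      simp only [id]
      linarith
    · refine tendsto_atBot_mono' _ ?_ (tendsto_id.const_mul_atBot (inv_pos.2 hM))
      filter_upwards [eventually_le_atBot 0] with x hx
      have := hgrow hx
      simp only [hτ0] at this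
      simp only [id]
      linarith
  let e := hmono.orderIsoOfSurjective τ hsurj
  have he : ∀ x, τ (e.symm x) = x := fun x => e.apply_symm_apply x
  have hadd : ∀ x, τ (x + P) = τ x + τ P := by
    intro x
    have hp : Function.Periodic (fun s => (h s)⁻¹) P := fun s => by simp only [hper s]
    have := hp.intervalIntegral_add_eq x 0
    rw [zero_add] at this
    simp only [hτ]
    rw [← this, intervalIntegral.integral_add_adjacent_intervals] <;>
      exact hinv.intervalIntegrable _ _
  refine ⟨e.symm, τ P, ?_, fun t => ?_, fun t => hmono.injective ?_⟩
  · rw [← hτ0]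
    exact hmono hP
  · have := HasDerivAt.of_local_left_inverse e.symm.continuous.continuousAt (hderiv (e.symm t))
      (inv_pos.2 (hpos _)).ne' (Eventually.of_forall he)
    rwa [inv_inv] at this
  · rw [he, hadd, he]
/-- The form whose unit level set is the transversal ellipse lying between the two limit cycles. -/
noncomputable def innerForm (s c : ℝ) : ℝ :=
  167006 / 100000 * s ^ 2 + 13336 / 100000 * (s * c) + 166205 / 100000 * c ^ 2

/-- The derivative of `innerForm` along rotations. -/
noncomputable def innerFormDeriv (s c : ℝ) : ℝ :=
  2 * (167006 / 100000 - 166205 / 100000) * (s * c) + 13336 / 100000 * (c ^ 2 - s ^ 2)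

/-- The quartic form defining the transversal curve that encloses both limit cycles. -/
noncomputable def outerForm (s c : ℝ) : ℝ :=
  73 / 100 * s ^ 4 - 37 / 100 * (s ^ 3 * c) + 118 / 100 * (s ^ 2 * c ^ 2) - 5 / 100 * (s * c ^ 3)
    + 625 / 1000 * c ^ 4

/-- The derivative of `outerForm` along rotations. -/
noncomputable def outerFormDeriv (s c : ℝ) : ℝ :=
  4 * (73 / 100) * (s ^ 3 * c) - 37 / 100 * (3 * s ^ 2 * c ^ 2 - s ^ 4)
    + 2 * (118 / 100) * (s * c ^ 3 - s ^ 3 * c) - 5 / 100 * (c ^ 4 - 3 * s ^ 2 * c ^ 2)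
    - 4 * (625 / 1000) * (s * c ^ 3)

theorem innerForm_ge {s c : ℝ} (h : s ^ 2 + c ^ 2 = 1) : 25 / 48 ≤ innerForm s c := by
  unfold innerForm
  nlinarith [sq_nonneg (s + c), sq_nonneg s]

theorem outerForm_ge {s c : ℝ} (h : s ^ 2 + c ^ 2 = 1) : 25 / 48 ≤ outerForm s c := by
  have h2 : (s ^ 2 + c ^ 2) ^ 2 = 1 := by rw [h, one_pow]
  unfold outerForm
  nlinarith [h2, sq_nonneg (20 * s ^ 2 - 19 * s * c - 5 * c ^ 2), sq_nonneg (s ^ 2 - s * c),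
    sq_nonneg (s * c - c ^ 2), sq_nonneg (s ^ 2 - c ^ 2), sq_nonneg (s ^ 2 - s * c - c ^ 2),
    sq_nonneg (2 * s ^ 2 - 2 * s * c - c ^ 2), sq_nonneg (s * c)]

theorem innerForm_transversal {s c : ℝ} (h : s ^ 2 + c ^ 2 = 1) :
    0 < innerFormDeriv s c * innerForm s c ^ 2
      - (innerFormDeriv s c * (s * c) + 2 * innerForm s c * s ^ 2)
        * (s ^ 4 - s ^ 2 * innerForm s c + 19991 / 100000 * innerForm s c ^ 2) := by
  have hrot : innerFormDeriv s c * (s * c) + 2 * innerForm s c * s ^ 2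
      = s * (2 * (167006 / 100000) * s + 13336 / 100000 * c) := by
    unfold innerForm innerFormDeriv
    linear_combination (s * (2 * (167006 / 100000) * s + 13336 / 100000 * c)) * h
  have h6 : (s ^ 2 + c ^ 2) ^ 3 = 1 := by rw [h, one_pow]
  rw [hrot]
  unfold innerForm innerFormDeriv
  linarith [h6, sq_nonneg (-60327 * c ^ 3 - 2623 * s * c ^ 2 + 120742 * s ^ 2 * c + 6141 * s ^ 3),
    sq_nonneg (6671 * c ^ 3 - 1437 * s * c ^ 2 - 14268 * s ^ 2 * c ),
    sq_nonneg (s ^ 3), sq_nonneg (s ^ 2 * c), sq_nonneg (s * c ^ 2), sq_nonneg (c ^ 3),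
    sq_nonneg (s ^ 3 + s ^ 2 * c), sq_nonneg (s ^ 3 - s ^ 2 * c),
    sq_nonneg (s ^ 2 * c + s * c ^ 2), sq_nonneg (s ^ 2 * c - s * c ^ 2),
    sq_nonneg (s * c ^ 2 + c ^ 3), sq_nonneg (s * c ^ 2 - c ^ 3)]

theorem outerForm_transversal {s c : ℝ} (h : s ^ 2 + c ^ 2 = 1) :
    outerFormDeriv s c * outerForm s c ^ 2
      - (outerFormDeriv s c * (s * c) + 2 * outerForm s c * s ^ 2)
        * (s ^ 4 - s ^ 2 * outerForm s c + 0 * outerForm s c ^ 2) < 0 := by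
  have hom : outerFormDeriv s c * outerForm s c ^ 2 * (s ^ 2 + c ^ 2)
      - (outerFormDeriv s c * (s * c) + 2 * outerForm s c * s ^ 2)
        * (s ^ 4 * (s ^ 2 + c ^ 2) ^ 2 - s ^ 2 * outerForm s c * (s ^ 2 + c ^ 2)) < 0 := by
    have h14 : (s ^ 2 + c ^ 2) ^ 7 = 1 := by rw [h, one_pow]
    unfold outerForm outerFormDeriv
    linarith [h14, 
      sq_nonneg (-4 * c ^ 7 - 116 * s * c ^ 6 + 41 * s ^ 2 * c ^ 5 + 658 * s ^ 3 * c ^ 4 - 144 * s ^ 4 * c ^ 3 - 510 * s ^ 5 * c ^ 2 + 39 * s ^ 6 * c + 44 * s ^ 7),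
      sq_nonneg (12 * c ^ 7 - 16 * s * c ^ 6 - 382 * s ^ 2 * c ^ 5 + 91 * s ^ 3 * c ^ 4 + 710 * s ^ 4 * c ^ 3 - 120 * s ^ 5 * c ^ 2 - 224 * s ^ 6 * c ),
      sq_nonneg (s ^ 7), sq_nonneg (s ^ 6 * c), sq_nonneg (s ^ 5 * c ^ 2),
      sq_nonneg (s ^ 4 * c ^ 3), sq_nonneg (s ^ 3 * c ^ 4), sq_nonneg (s ^ 2 * c ^ 5),
      sq_nonneg (s * c ^ 6), sq_nonneg (c ^ 7), sq_nonneg (s * c ^ 6 - c ^ 7),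
      sq_nonneg (s ^ 2 * c ^ 5 + s * c ^ 6),
      sq_nonneg (s ^ 3 * c ^ 4 - s ^ 2 * c ^ 5),
      sq_nonneg (s ^ 4 * c ^ 3 + s ^ 3 * c ^ 4),
      sq_nonneg (s ^ 5 * c ^ 2 - s ^ 4 * c ^ 3),
      sq_nonneg (s ^ 6 * c + s ^ 5 * c ^ 2),
      sq_nonneg (s ^ 7 - s ^ 6 * c )]
  rw [h] at hom
  linarith

/-- A global integral curve of a periodic vector field which returns to its initial value after one
period is periodic. -/
theorem IsIntegralCurve.periodic {v : ℝ → ℝ → ℝ} {K : ℝ≥0} {P : ℝ} {α : ℝ → ℝ}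
    (hα : IsIntegralCurve α v) (hlip : ∀ t, LipschitzWith K (v t)) (hper : Function.Periodic v P)
    (hret : α P = α 0) : Function.Periodic α P := by
  have hshift : IsIntegralCurve (fun t => α (t + P)) v := fun t => by
    have := (hα (t + P)).comp_add_const t P
    rwa [hper t] at this
  have := ODE_solution_unique_univ (v := v) (K := K) (s := fun _ => univ) (t₀ := 0)
    (fun t => (hlip t).lipschitzOnWith) (fun t => ⟨hshift t, trivial⟩) (fun t => ⟨hα t, trivial⟩)
    (by simpa using hret)
  exact fun t => congrFun this t

/-- If the period map of a bounded, globally Lipschitz scalar equation moves two points in opposite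
directions, then there is a periodic integral curve starting between them. -/
theorem exists_periodic_isIntegralCurve {v : ℝ → ℝ → ℝ} {K M : ℝ≥0} {P a b : ℝ}
    (hlip : ∀ t, LipschitzWith K (v t)) (hcont : ∀ x, Continuous (v · x))
    (hbound : ∀ t x, ‖v t x‖ ≤ M) (hper : Function.Periodic v P) (hP : 0 ≤ P) (hab : a ≤ b)
    (hcross : ∀ α β : ℝ → ℝ, IsIntegralCurve α v → IsIntegralCurve β v → α 0 = a → β 0 = b →
      0 ∈ uIcc (α P - a) (β P - b)) :
    ∃ α : ℝ → ℝ, IsIntegralCurve α v ∧ Function.Periodic α P ∧ α 0 ∈ Icc a b := by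
  choose α h0 hα using exists_isIntegralCurve_of_bounded hlip hcont hbound
  have hmap : ContinuousOn (fun x => α x P - x) (uIcc a b) :=
    ((continuous_flow_map hlip h0 hα hP).sub continuous_id).continuousOn
  obtain ⟨x, hx, hx0⟩ :=
    intermediate_value_uIcc hmap (hcross (α a) (α b) (hα a) (hα b) (h0 a) (h0 b))
  refine ⟨α x, hα x, (hα x).periodic hlip hper ?_, ?_⟩
  · rw [h0]
    exact sub_eq_zero.1 hx0
  · rwa [h0, ← uIcc_of_le hab]

/-- A strict subsolution stays below every integral curve that starts above it. -/
theorem IsIntegralCurve.subsolution_le {v : ℝ → ℝ → ℝ} {α L L' : ℝ → ℝ} {t : ℝ}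
    (hα : IsIntegralCurve α v) (hL : ∀ t, HasDerivAt L (L' t) t) (hlt : ∀ t, L' t < v t (L t))
    (h0 : L 0 ≤ α 0) (ht : 0 ≤ t) : L t ≤ α t :=
  image_le_of_deriv_right_lt_deriv_boundary
    (fun s _ => (hL s).continuousAt.continuousWithinAt) (fun s _ => (hL s).hasDerivWithinAt)
    h0 hα (fun s _ hs => hs ▸ hlt s) ⟨ht, le_rfl⟩

/-- A strict supersolution stays above every integral curve that starts below it. -/
theorem IsIntegralCurve.le_supersolution {v : ℝ → ℝ → ℝ} {α U U' : ℝ → ℝ} {t : ℝ}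
    (hα : IsIntegralCurve α v) (hU : ∀ t, HasDerivAt U (U' t) t) (hlt : ∀ t, v t (U t) < U' t)
    (h0 : α 0 ≤ U 0) (ht : 0 ≤ t) : α t ≤ U t :=
  image_le_of_deriv_right_lt_deriv_boundary
    hα.continuous.continuousOn (fun s _ => (hα s).hasDerivWithinAt)
    h0 hU (fun s _ hs => hs ▸ hlt s) ⟨ht, le_rfl⟩

theorem Function.Periodic.le_of_forall_nonneg {f g : ℝ → ℝ} {P : ℝ} (hf : Function.Periodic f P)
    (hg : Function.Periodic g P) (hP : 0 < P) (h : ∀ t, 0 ≤ t → f t ≤ g t) (t : ℝ) :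
    f t ≤ g t := by
  obtain ⟨n, hn⟩ := exists_nat_gt (-t / P)
  rw [div_lt_iff₀ hP] at hn
  rw [← hf.nat_mul n t, ← hg.nat_mul n t]
  exact h _ (by linarith)

/-- A periodic strict subsolution stays strictly below every periodic integral curve that starts
above it. -/
theorem IsIntegralCurve.subsolution_lt {v : ℝ → ℝ → ℝ} {α L L' : ℝ → ℝ} {P : ℝ}
    (hα : IsIntegralCurve α v) (hL : ∀ t, HasDerivAt L (L' t) t) (hlt : ∀ t, L' t < v t (L t))
    (h0 : L 0 ≤ α 0) (hαP : Function.Periodic α P) (hLP : Function.Periodic L P) (hP : 0 < P)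
    (t : ℝ) : L t < α t := by
  have hle := hLP.le_of_forall_nonneg hαP hP fun s hs => hα.subsolution_le hL hlt h0 hs
  refine (hle t).lt_of_ne fun heq => ?_
  have hmin : IsLocalMin (fun s => α s - L s) t := Eventually.of_forall fun s => by
    have := hle s
    simp only
    linarith
  have := hmin.hasDerivAt_eq_zero ((hα t).sub (hL t))
  have := hlt t
  rw [heq] at this
  linarith

/-! ### The Rychkov system in polar coordinates

For `(x, y) = (√ρ sin θ, √ρ cos θ)` the system becomes a scalar equation for `ρ` as a function of
`θ`, as long as the angular speed is positive. -/

/-- The factor `x⁴ - x² + δ` of the damping term, as a function of `w = x²`. -/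
noncomputable def dampingFactor (δ w : ℝ) : ℝ := w ^ 2 - w + δ

/-- The angular speed at squared radius `ρ`. -/
noncomputable def angularSpeed (δ θ ρ : ℝ) : ℝ :=
  1 - Real.sin θ * Real.cos θ * dampingFactor δ (ρ * Real.sin θ ^ 2)

/-- The derivative of the squared radius with respect to the angle. -/
noncomputable def radialField (δ θ ρ : ℝ) : ℝ :=
  -2 * (ρ * Real.sin θ ^ 2) * dampingFactor δ (ρ * Real.sin θ ^ 2) / angularSpeed δ θ ρ

/-- Truncation of the squared radius to a range where the angular speed is positive. -/
noncomputable def cutoff (ρ : ℝ) : ℝ := max 0 (min ρ (48 / 25))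

/-- The radial field, made bounded and globally Lipschitz by truncation. -/
noncomputable def truncatedField (δ θ ρ : ℝ) : ℝ := radialField δ θ (cutoff ρ)

theorem cutoff_mem (ρ : ℝ) : cutoff ρ ∈ Icc 0 (48 / 25) :=
  ⟨le_max_left _ _, max_le (by norm_num) (min_le_right _ _)⟩

theorem cutoff_eq_self {ρ : ℝ} (h : ρ ∈ Icc 0 (48 / 25)) : cutoff ρ = ρ := by
  rw [cutoff, min_eq_left h.2, max_eq_right h.1]

theorem abs_cutoff_sub_le (x y : ℝ) : |cutoff x - cutoff y| ≤ |x - y| := by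
  have : LipschitzWith 1 cutoff := (LipschitzWith.id.min_const _).const_max _
  simpa [Real.dist_eq] using this.dist_le_mul x y

theorem mul_sin_sq_mem {ρ : ℝ} (hρ : ρ ∈ Icc (0 : ℝ) (48 / 25)) (θ : ℝ) :
    ρ * Real.sin θ ^ 2 ∈ Icc (0 : ℝ) (48 / 25) :=
  ⟨mul_nonneg hρ.1 (sq_nonneg _),
    (mul_le_of_le_one_right hρ.1 (Real.sin_sq_le_one θ)).trans hρ.2⟩

theorem abs_sin_mul_cos_le (θ : ℝ) : |Real.sin θ * Real.cos θ| ≤ 1 / 2 := by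
  have := Real.sin_sq_add_cos_sq θ
  rw [abs_le]
  constructor <;>
    nlinarith [sq_nonneg (Real.sin θ + Real.cos θ), sq_nonneg (Real.sin θ - Real.cos θ)]

theorem abs_dampingFactor_le {δ w : ℝ} (hδ : δ ∈ Icc (0 : ℝ) (1 / 5))
    (hw : w ∈ Icc (0 : ℝ) (48 / 25)) : |dampingFactor δ w| ≤ 197 / 100 := by
  obtain ⟨hδ0, hδ1⟩ := hδ
  obtain ⟨hw0, hw1⟩ := hw
  rw [dampingFactor, abs_le]
  constructor <;> nlinarith [mul_nonneg hw0 (sub_nonneg.2 hw1), sq_nonneg (w - 1 / 2)]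

theorem angularSpeed_mem {δ θ ρ : ℝ} (hδ : δ ∈ Icc (0 : ℝ) (1 / 5))
    (hρ : ρ ∈ Icc (0 : ℝ) (48 / 25)) : angularSpeed δ θ ρ ∈ Icc (1 / 100 : ℝ) 2 := by
  have h : |Real.sin θ * Real.cos θ * dampingFactor δ (ρ * Real.sin θ ^ 2)|
      ≤ 1 / 2 * (197 / 100) := by
    rw [abs_mul]
    exact mul_le_mul (abs_sin_mul_cos_le θ) (abs_dampingFactor_le hδ (mul_sin_sq_mem hρ θ))
      (abs_nonneg _) (by norm_num)
  rw [abs_le] at h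
  rw [angularSpeed]
  constructor <;> linarith [h.1, h.2]

theorem angularSpeed_pos {δ θ ρ : ℝ} (hδ : δ ∈ Icc (0 : ℝ) (1 / 5))
    (hρ : ρ ∈ Icc (0 : ℝ) (48 / 25)) : 0 < angularSpeed δ θ ρ :=
  lt_of_lt_of_le (by norm_num) (angularSpeed_mem hδ hρ).1

theorem radialField_add_pi (δ θ ρ : ℝ) : radialField δ (θ + Real.pi) ρ = radialField δ θ ρ := by
  simp [radialField, angularSpeed, Real.sin_add_pi, Real.cos_add_pi]

theorem radialField_anti {δ δ' θ ρ : ℝ} (hδ : δ ∈ Icc (0 : ℝ) (1 / 5))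
    (hδ' : δ' ∈ Icc (0 : ℝ) (1 / 5)) (hle : δ ≤ δ') (hρ : ρ ∈ Icc (0 : ℝ) (48 / 25)) :
    radialField δ' θ ρ ≤ radialField δ θ ρ := by
  have hw := (mul_sin_sq_mem hρ θ).1
  rw [radialField, radialField,
    div_le_div_iff₀ (angularSpeed_pos hδ' hρ) (angularSpeed_pos hδ hρ), angularSpeed, angularSpeed,
    dampingFactor, dampingFactor]
  nlinarith [mul_nonneg hw (sub_nonneg.2 hle)]

theorem abs_radialField_le {δ θ ρ : ℝ} (hδ : δ ∈ Icc (0 : ℝ) (1 / 5))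
    (hρ : ρ ∈ Icc (0 : ℝ) (48 / 25)) : |radialField δ θ ρ| ≤ 800 := by
  have hw := mul_sin_sq_mem hρ θ
  have hH := angularSpeed_mem (θ := θ) hδ hρ
  have hpos := angularSpeed_pos (θ := θ) hδ hρ
  rw [radialField, abs_div, abs_of_pos hpos, div_le_iff₀ hpos, abs_mul, abs_mul, abs_of_nonneg hw.1]
  norm_num only [abs_neg, abs_two]
  nlinarith [hH.1, mul_le_mul hw.2 (abs_dampingFactor_le hδ hw) (abs_nonneg _) (by norm_num)]

theorem abs_radialField_sub_le {δ θ ρ₁ ρ₂ : ℝ} (hδ : δ ∈ Icc (0 : ℝ) (1 / 5))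
    (h₁ : ρ₁ ∈ Icc (0 : ℝ) (48 / 25)) (h₂ : ρ₂ ∈ Icc (0 : ℝ) (48 / 25)) :
    |radialField δ θ ρ₁ - radialField δ θ ρ₂| ≤ 1000000 * |ρ₁ - ρ₂| := by
  have hH₁ := angularSpeed_mem (θ := θ) hδ h₁
  have hH₂ := angularSpeed_mem (θ := θ) hδ h₂
  have hw₁ := mul_sin_sq_mem h₁ θ
  have hw₂ := mul_sin_sq_mem h₂ θ
  have hk := abs_sin_mul_cos_le θ
  have hp₁ := angularSpeed_pos (θ := θ) hδ h₁
  have hp₂ := angularSpeed_pos (θ := θ) hδ h₂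
  have hwsub : |ρ₁ * Real.sin θ ^ 2 - ρ₂ * Real.sin θ ^ 2| ≤ |ρ₁ - ρ₂| := by
    rw [← sub_mul, abs_mul, abs_of_nonneg (sq_nonneg (Real.sin θ))]
    exact mul_le_of_le_one_right (abs_nonneg _) (Real.sin_sq_le_one θ)
  have hHdef₁ : angularSpeed δ θ ρ₁ =
    1 - Real.sin θ * Real.cos θ * dampingFactor δ (ρ₁ * Real.sin θ ^ 2) := rfl
  have hHdef₂ : angularSpeed δ θ ρ₂ =
    1 - Real.sin θ * Real.cos θ * dampingFactor δ (ρ₂ * Real.sin θ ^ 2) := rfl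
  -- Since `H₁, H₂` are affine in the damping factor, cross terms cancel.
  have hdiff : radialField δ θ ρ₁ - radialField δ θ ρ₂ =
      -2 * (ρ₁ * Real.sin θ ^ 2 - ρ₂ * Real.sin θ ^ 2) * (
        (ρ₁ * Real.sin θ ^ 2) ^ 2 + ρ₁ * Real.sin θ ^ 2 * (ρ₂ * Real.sin θ ^ 2)
          + (ρ₂ * Real.sin θ ^ 2) ^ 2 - ρ₁ * Real.sin θ ^ 2 - ρ₂ * Real.sin θ ^ 2 + δ
        - Real.sin θ * Real.cos θ * (dampingFactor δ (ρ₁ * Real.sin θ ^ 2)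
          * dampingFactor δ (ρ₂ * Real.sin θ ^ 2)))
      / (angularSpeed δ θ ρ₁ * angularSpeed δ θ ρ₂) := by
    rw [radialField, radialField, div_sub_div _ _ hp₁.ne' hp₂.ne', hHdef₁, hHdef₂]
    congr 1
    simp only [dampingFactor]
    ring
  have hq₁ := abs_dampingFactor_le hδ hw₁
  have hq₂ := abs_dampingFactor_le hδ hw₂
  generalize ρ₁ * Real.sin θ ^ 2 = w₁ at *
  generalize ρ₂ * Real.sin θ ^ 2 = w₂ at *
  have hkq : |Real.sin θ * Real.cos θ * (dampingFactor δ w₁ * dampingFactor δ w₂)|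
      ≤ 1 / 2 * (197 / 100 * (197 / 100)) := by
    rw [abs_mul, abs_mul (dampingFactor δ w₁)]
    gcongr
  have hfac : |w₁ ^ 2 + w₁ * w₂ + w₂ ^ 2 - w₁ - w₂ + δ
      - Real.sin θ * Real.cos θ * (dampingFactor δ w₁ * dampingFactor δ w₂)| ≤ 50 := by
    rw [abs_le] at hkq ⊢
    obtain ⟨hδ0, hδ1⟩ := hδ
    obtain ⟨hw10, hw11⟩ := hw₁
    obtain ⟨hw20, hw21⟩ := hw₂
    constructor <;>
      nlinarith [mul_nonneg hw10 hw20, mul_nonneg hw10 (sub_nonneg.2 hw11),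
        mul_nonneg hw20 (sub_nonneg.2 hw21), mul_nonneg hw10 (sub_nonneg.2 hw21)]
  have hprod : (1 / 10000 : ℝ) ≤ angularSpeed δ θ ρ₁ * angularSpeed δ θ ρ₂ := by
    nlinarith [hH₁.1, hH₂.1]
  have hpp := mul_pos hp₁ hp₂
  rw [hdiff, abs_div, abs_of_pos hpp, div_le_iff₀ hpp, abs_mul, abs_mul]
  norm_num only [abs_neg, abs_two]
  calc 2 * |w₁ - w₂| * _ ≤ 2 * |ρ₁ - ρ₂| * 50 := by gcongr
    _ ≤ 1000000 * |ρ₁ - ρ₂| * (1 / 10000) := by linarith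
    _ ≤ _ := by gcongr

theorem continuous_angularSpeed {δ : ℝ} {ρ : ℝ → ℝ} (hρ : Continuous ρ) :
    Continuous fun θ => angularSpeed δ θ (ρ θ) := by
  unfold angularSpeed dampingFactor
  fun_prop

theorem truncatedField_lipschitz {δ : ℝ} (hδ : δ ∈ Icc (0 : ℝ) (1 / 5)) (θ : ℝ) :
    LipschitzWith 1000000 (truncatedField δ θ) :=
  LipschitzWith.of_dist_le_mul fun x y =>
    (abs_radialField_sub_le hδ (cutoff_mem x) (cutoff_mem y)).trans
      (mul_le_mul_of_nonneg_left (abs_cutoff_sub_le x y) (by norm_num))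

theorem truncatedField_continuous {δ : ℝ} (hδ : δ ∈ Icc (0 : ℝ) (1 / 5)) (ρ : ℝ) :
    Continuous (truncatedField δ · ρ) := by
  refine Continuous.div ?_ (continuous_angularSpeed continuous_const)
    fun θ => (angularSpeed_pos hδ (cutoff_mem ρ)).ne'
  unfold dampingFactor
  fun_prop

theorem truncatedField_bound {δ : ℝ} (hδ : δ ∈ Icc (0 : ℝ) (1 / 5)) (θ ρ : ℝ) :
    ‖truncatedField δ θ ρ‖ ≤ (800 : ℝ≥0) :=
  abs_radialField_le hδ (cutoff_mem ρ)

theorem truncatedField_periodic (δ : ℝ) : Function.Periodic (truncatedField δ) Real.pi :=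
  fun θ => funext fun ρ => radialField_add_pi δ θ (cutoff ρ)

theorem truncatedField_eq {δ θ ρ : ℝ} (hρ : ρ ∈ Icc (0 : ℝ) (48 / 25)) :
    truncatedField δ θ ρ = radialField δ θ ρ := by
  rw [truncatedField, cutoff_eq_self hρ]

/-- The defect of the radial equation along the polar curve `ρ = 1 / D`. -/
theorem radialField_inv_add {δ θ D D' : ℝ} (hD : D ≠ 0) (hH : angularSpeed δ θ D⁻¹ ≠ 0) :
    radialField δ θ D⁻¹ + D' / D ^ 2 =
      (D' * D ^ 2 - (D' * (Real.sin θ * Real.cos θ) + 2 * D * Real.sin θ ^ 2)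
        * (Real.sin θ ^ 4 - Real.sin θ ^ 2 * D + δ * D ^ 2)) / (D ^ 4 * angularSpeed δ θ D⁻¹) := by
  have hdef : angularSpeed δ θ D⁻¹ = 1 - Real.sin θ * Real.cos θ *
    ((D⁻¹ * Real.sin θ ^ 2) ^ 2 - D⁻¹ * Real.sin θ ^ 2 + δ) := rfl
  rw [radialField, dampingFactor, div_add_div _ _ hH (pow_ne_zero 2 hD),
    div_eq_div_iff (mul_ne_zero hH (pow_ne_zero 2 hD)) (mul_ne_zero (pow_ne_zero 4 hD) hH), hdef]
  field_simp
  ring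

theorem inv_mem_of_ge {D : ℝ} (hD : 25 / 48 ≤ D) : D⁻¹ ∈ Icc (0 : ℝ) (48 / 25) := by
  have hpos : (0 : ℝ) < D := lt_of_lt_of_le (by norm_num) hD
  refine ⟨inv_nonneg.2 hpos.le, ?_⟩
  have := inv_anti₀ (by norm_num) hD
  norm_num at this ⊢
  exact this

theorem inner_subsolution {δ : ℝ} (hδ : δ ∈ Icc (0 : ℝ) (19991 / 100000)) (θ : ℝ) :
    -innerFormDeriv (Real.sin θ) (Real.cos θ) / innerForm (Real.sin θ) (Real.cos θ) ^ 2
      < truncatedField δ θ (innerForm (Real.sin θ) (Real.cos θ))⁻¹ := by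
  have hcirc := Real.sin_sq_add_cos_sq θ
  have hge := innerForm_ge hcirc
  have hpoly := innerForm_transversal hcirc
  have hmem := inv_mem_of_ge hge
  generalize innerForm (Real.sin θ) (Real.cos θ) = D at *
  have hD : 0 < D := lt_of_lt_of_le (by norm_num) hge
  have hδ' : δ ∈ Icc (0 : ℝ) (1 / 5) := ⟨hδ.1, hδ.2.trans (by norm_num)⟩
  have hδ₁ : (19991 / 100000 : ℝ) ∈ Icc (0 : ℝ) (1 / 5) := by constructor <;> norm_num
  have hH := angularSpeed_pos (θ := θ) hδ₁ hmem
  have hdefect := radialField_inv_add (D' := innerFormDeriv (Real.sin θ) (Real.cos θ)) hD.ne' hH.ne'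
  have := div_pos hpoly (mul_pos (pow_pos hD 4) hH)
  rw [truncatedField_eq hmem, neg_div]
  linarith [radialField_anti (θ := θ) hδ' hδ₁ hδ.2 hmem]

theorem outer_supersolution {δ : ℝ} (hδ : δ ∈ Icc (0 : ℝ) (1 / 5)) (θ : ℝ) :
    truncatedField δ θ (outerForm (Real.sin θ) (Real.cos θ))⁻¹
      < -outerFormDeriv (Real.sin θ) (Real.cos θ) / outerForm (Real.sin θ) (Real.cos θ) ^ 2 := by
  have hcirc := Real.sin_sq_add_cos_sq θ
  have hge := outerForm_ge hcirc
  have hpoly := outerForm_transversal hcirc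
  have hmem := inv_mem_of_ge hge
  generalize outerForm (Real.sin θ) (Real.cos θ) = D at *
  have hD : 0 < D := lt_of_lt_of_le (by norm_num) hge
  have hδ₀ : (0 : ℝ) ∈ Icc (0 : ℝ) (1 / 5) := by constructor <;> norm_num
  have hH := angularSpeed_pos (θ := θ) hδ₀ hmem
  have hdefect := radialField_inv_add (D' := outerFormDeriv (Real.sin θ) (Real.cos θ)) hD.ne' hH.ne'
  have := div_neg_of_neg_of_pos hpoly (mul_pos (pow_pos hD 4) hH)
  rw [truncatedField_eq hmem, neg_div]
  linarith [radialField_anti (θ := θ) hδ₀ hδ hδ.1 hmem]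

theorem hasDerivAt_inv_innerForm (θ : ℝ) :
    HasDerivAt (fun θ => (innerForm (Real.sin θ) (Real.cos θ))⁻¹)
      (-innerFormDeriv (Real.sin θ) (Real.cos θ) / innerForm (Real.sin θ) (Real.cos θ) ^ 2) θ := by
  have hs := Real.hasDerivAt_sin θ
  have hc := Real.hasDerivAt_cos θ
  have hD : HasDerivAt (fun θ => innerForm (Real.sin θ) (Real.cos θ))
      (innerFormDeriv (Real.sin θ) (Real.cos θ)) θ := by
    refine HasDerivAt.congr_deriv ((((hs.pow 2).const_mul _).add ((hs.mul hc).const_mul _)).add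
      ((hc.pow 2).const_mul _)) ?_
    unfold innerFormDeriv
    push_cast
    ring
  exact hD.inv (lt_of_lt_of_le (by norm_num) (innerForm_ge (Real.sin_sq_add_cos_sq θ))).ne'

theorem hasDerivAt_inv_outerForm (θ : ℝ) :
    HasDerivAt (fun θ => (outerForm (Real.sin θ) (Real.cos θ))⁻¹)
      (-outerFormDeriv (Real.sin θ) (Real.cos θ) / outerForm (Real.sin θ) (Real.cos θ) ^ 2) θ := by
  have hs := Real.hasDerivAt_sin θ
  have hc := Real.hasDerivAt_cos θ
  have hD : HasDerivAt (fun θ => outerForm (Real.sin θ) (Real.cos θ))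
      (outerFormDeriv (Real.sin θ) (Real.cos θ)) θ := by
    refine HasDerivAt.congr_deriv ((((((hs.pow 4).const_mul _).sub
      (((hs.pow 3).mul hc).const_mul _)).add (((hs.pow 2).mul (hc.pow 2)).const_mul _)).sub
      ((hs.mul (hc.pow 3)).const_mul _)).add ((hc.pow 4).const_mul _)) ?_
    unfold outerFormDeriv
    simp only [Pi.pow_apply]
    push_cast
    ring
  exact hD.inv (lt_of_lt_of_le (by norm_num) (outerForm_ge (Real.sin_sq_add_cos_sq θ))).ne'

theorem periodic_inv_innerForm :
    Function.Periodic (fun θ => (innerForm (Real.sin θ) (Real.cos θ))⁻¹) Real.pi := fun θ => by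
  simp [innerForm, Real.sin_add_pi, Real.cos_add_pi]

theorem periodic_inv_outerForm :
    Function.Periodic (fun θ => (outerForm (Real.sin θ) (Real.cos θ))⁻¹) Real.pi := fun θ => by
  simp only [outerForm, Real.sin_add_pi, Real.cos_add_pi]
  congr 1
  ring

/-- Near the origin the squared radius does not increase over a half turn. -/
theorem map_pi_le_of_small {δ : ℝ} (hδ : δ ∈ Ioc (0 : ℝ) (1 / 5)) {α : ℝ → ℝ}
    (hα : IsIntegralCurve α (truncatedField δ)) (h0 : α 0 = δ / 2) : α Real.pi ≤ δ / 2 := by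
  have hδ' : δ ∈ Icc (0 : ℝ) (1 / 5) := Ioc_subset_Icc_self hδ
  have hnonpos : ∀ θ ρ, ρ < δ → truncatedField δ θ ρ ≤ 0 := by
    intro θ ρ hρ
    have hmem := cutoff_mem ρ
    have hw := (mul_sin_sq_mem hmem θ).1
    have hcut : cutoff ρ ≤ δ := max_le hδ.1.le ((min_le_left _ _).trans hρ.le)
    have hwle : cutoff ρ * Real.sin θ ^ 2 ≤ δ :=
      (mul_le_of_le_one_right hmem.1 (Real.sin_sq_le_one θ)).trans hcut
    have hq : 0 ≤ dampingFactor δ (cutoff ρ * Real.sin θ ^ 2) := by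
      rw [dampingFactor]
      nlinarith [sq_nonneg (cutoff ρ * Real.sin θ ^ 2)]
    refine div_nonpos_of_nonpos_of_nonneg ?_ (angularSpeed_pos hδ' hmem).le
    nlinarith [mul_nonneg hw hq]
  have hlt : ∀ t ∈ Icc 0 Real.pi, α t < δ := by
    intro t ht
    have hU : ∀ s, HasDerivAt (fun s => δ / 2 + δ / 8 * s) (δ / 8) s := fun s => by
      simpa using ((hasDerivAt_id s).const_mul (δ / 8)).const_add (δ / 2)
    have hbelow : α t ≤ δ / 2 + δ / 8 * t := by
      refine image_le_of_deriv_right_lt_deriv_boundary (a := 0) (b := Real.pi)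
        hα.continuous.continuousOn (fun s _ => (hα s).hasDerivWithinAt) (by simp [h0]) hU ?_ ht
      intro s hs heq
      refine (hnonpos s _ ?_).trans_lt (by linarith [hδ.1])
      rw [heq]
      nlinarith [hs.2, Real.pi_lt_four, hδ.1]
    nlinarith [ht.2, Real.pi_lt_four, hδ.1]
  have hanti : AntitoneOn α (Icc 0 Real.pi) := by
    refine antitoneOn_of_hasDerivWithinAt_nonpos (convex_Icc _ _) hα.continuous.continuousOn
      (fun t _ => (hα t).hasDerivWithinAt) fun t ht => hnonpos t _ (hlt t (interior_subset ht))
  rw [← h0]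
  exact hanti ⟨le_rfl, Real.pi_pos.le⟩ ⟨Real.pi_pos.le, le_rfl⟩ Real.pi_pos.le

/-- A closed polar curve solving the radial equation is traversed by a periodic solution of the
Rychkov system. -/
theorem exists_periodic_orbit {δ : ℝ} {ρ : ℝ → ℝ}
    (hρ : ∀ θ, HasDerivAt ρ (radialField δ θ (ρ θ)) θ) (hpos : ∀ θ, 0 < ρ θ)
    (hper : Function.Periodic ρ Real.pi)
    (hspeed : ∀ θ, angularSpeed δ θ (ρ θ) ∈ Ioc 0 2) :
    ∃ (γ : ℝ → ℝ × ℝ) (T : ℝ), 0 < T ∧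
      (∀ t : ℝ, HasDerivAt γ
        ((γ t).2 - ((γ t).1 ^ 5 - (γ t).1 ^ 3 + δ * (γ t).1), -(γ t).1) t) ∧
      (∀ t : ℝ, γ (t + T) = γ t) ∧ (∃ t₁ t₂ : ℝ, γ t₁ ≠ γ t₂) ∧
      ∀ t, ∃ θ, γ t = (√(ρ θ) * Real.sin θ, √(ρ θ) * Real.cos θ) := by
  have hρcont : Continuous ρ := continuous_iff_continuousAt.2 fun θ => (hρ θ).continuousAt
  have hper2 : Function.Periodic ρ (2 * Real.pi) := by
    simpa using hper.nat_mul 2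
  obtain ⟨φ, T, hT, hφ, hφT⟩ := exists_motion_of_periodic_speed
    (h := fun θ => angularSpeed δ θ (ρ θ)) (continuous_angularSpeed hρcont)
    (fun θ => (hspeed θ).1) (fun θ => (hspeed θ).2)
    (P := 2 * Real.pi) (fun θ => by simp [angularSpeed, hper2 θ]) Real.two_pi_pos
  have hder : ∀ t, HasDerivAt
      (fun t => (√(ρ (φ t)) * Real.sin (φ t), √(ρ (φ t)) * Real.cos (φ t)))
      (√(ρ (φ t)) * Real.cos (φ t) - ((√(ρ (φ t)) * Real.sin (φ t)) ^ 5
        - (√(ρ (φ t)) * Real.sin (φ t)) ^ 3 + δ * (√(ρ (φ t)) * Real.sin (φ t))),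
        -(√(ρ (φ t)) * Real.sin (φ t))) t := by
    intro t
    have hr := ((hρ (φ t)).comp t (hφ t)).sqrt (hpos (φ t)).ne'
    have hs := (Real.hasDerivAt_sin (φ t)).comp t (hφ t)
    have hc := (Real.hasDerivAt_cos (φ t)).comp t (hφ t)
    have hH : angularSpeed δ (φ t) (ρ (φ t)) ≠ 0 := (hspeed (φ t)).1.ne'
    have hrpos : 0 < √(ρ (φ t)) := Real.sqrt_pos.2 (hpos (φ t))
    have hsq : ρ (φ t) = √(ρ (φ t)) ^ 2 := (Real.sq_sqrt (hpos (φ t)).le).symm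
    have hcirc := Real.sin_sq_add_cos_sq (φ t)
    have hradial : radialField δ (φ t) (ρ (φ t)) * angularSpeed δ (φ t) (ρ (φ t))
          / (2 * √(ρ (φ t)))
        = -(√(ρ (φ t)) * Real.sin (φ t) ^ 2
          * dampingFactor δ (ρ (φ t) * Real.sin (φ t) ^ 2)) := by
      rw [radialField, div_mul_cancel₀ _ hH, div_eq_iff (by positivity)]
      generalize dampingFactor δ (ρ (φ t) * Real.sin (φ t) ^ 2) = q
      linear_combination (-2 * Real.sin (φ t) ^ 2 * q) * hsq
    refine HasDerivAt.prodMk ((hr.mul hs).congr_deriv ?_) ((hr.mul hc).congr_deriv ?_)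
    · simp only [Function.comp_apply, hradial]
      rw [angularSpeed, dampingFactor, hsq, Real.sqrt_sq hrpos.le]
      generalize √(ρ (φ t)) = r
      generalize Real.sin (φ t) = s at *
      generalize Real.cos (φ t) = c at *
      linear_combination (-(r * s * ((r ^ 2 * s ^ 2) ^ 2 - r ^ 2 * s ^ 2 + δ))) * hcirc
    · simp only [Function.comp_apply, hradial]
      rw [angularSpeed]
      ring
  refine ⟨_, T, hT, hder, fun t => ?_, ?_, fun t => ⟨φ t, rfl⟩⟩
  · simp only [hφT, hper2 (φ t), Real.sin_add_two_pi, Real.cos_add_two_pi]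
  · by_contra! hconst
    have hzero := (hder 0).unique ((hasDerivAt_const (0 : ℝ) _).congr_of_eventuallyEq
      (Eventually.of_forall fun t => hconst t 0))
    have hr : √(ρ (φ 0)) ≠ 0 := (Real.sqrt_pos.2 (hpos (φ 0))).ne'
    have hx : √(ρ (φ 0)) * Real.sin (φ 0) = 0 := neg_eq_zero.1 (congrArg Prod.snd hzero)
    have hy := congrArg Prod.fst hzero
    simp only [hx] at hy
    have hs : Real.sin (φ 0) = 0 := by simpa [hr] using hx
    have hc : Real.cos (φ 0) = 0 := by simpa [hr] using hy
    have := Real.sin_sq_add_cos_sq (φ 0)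
    simp [hs, hc] at this

/-- Distinct points of polar curves lying one inside the other are distinct in the plane. -/
theorem polar_ne_of_lt {ρ₁ ρ₂ : ℝ → ℝ} (hpos₁ : ∀ θ, 0 < ρ₁ θ) (hlt : ∀ θ, ρ₁ θ < ρ₂ θ)
    (hper : Function.Periodic ρ₁ Real.pi) (θ₁ θ₂ : ℝ) :
    (√(ρ₁ θ₁) * Real.sin θ₁, √(ρ₁ θ₁) * Real.cos θ₁)
      ≠ (√(ρ₂ θ₂) * Real.sin θ₂, √(ρ₂ θ₂) * Real.cos θ₂) := by
  intro h
  obtain ⟨hx, hy⟩ := Prod.mk.inj h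
  have hpos₂ : 0 < ρ₂ θ₂ := (hpos₁ θ₂).trans (hlt θ₂)
  have hρ : ρ₁ θ₁ = ρ₂ θ₂ := by
    have h₁ := Real.sq_sqrt (hpos₁ θ₁).le
    have h₂ := Real.sq_sqrt hpos₂.le
    calc ρ₁ θ₁ = (√(ρ₁ θ₁) * Real.sin θ₁) ^ 2 + (√(ρ₁ θ₁) * Real.cos θ₁) ^ 2 := by
          linear_combination (-1 : ℝ) * h₁ - √(ρ₁ θ₁) ^ 2 * Real.sin_sq_add_cos_sq θ₁
      _ = ρ₂ θ₂ := by
          rw [hx, hy]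
          linear_combination h₂ + √(ρ₂ θ₂) ^ 2 * Real.sin_sq_add_cos_sq θ₂
  have hr : √(ρ₂ θ₂) ≠ 0 := (Real.sqrt_pos.2 hpos₂).ne'
  rw [hρ] at hx hy
  have hang := Real.Angle.cos_sin_inj (mul_left_cancel₀ hr hy) (mul_left_cancel₀ hr hx)
  obtain ⟨k, hk⟩ := Real.Angle.angle_eq_iff_two_pi_dvd_sub.1 hang
  have hθ : θ₁ = θ₂ + ((2 * k : ℤ) : ℝ) * Real.pi := by
    push_cast
    linarith
  have : ρ₁ θ₁ = ρ₁ θ₂ := by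
    rw [hθ]
    exact hper.int_mul (2 * k) θ₂
  linarith [hlt θ₂]

/-- Integral curves of the truncated radial equation which start in a fixed order keep it. -/
theorem truncatedField_order {δ : ℝ} (hδ : δ ∈ Icc (0 : ℝ) (1 / 5)) {α β : ℝ → ℝ}
    (hα : IsIntegralCurve α (truncatedField δ)) (hβ : IsIntegralCurve β (truncatedField δ))
    (h0 : α 0 < β 0) (θ : ℝ) : α θ < β θ := by
  by_contra! hle
  have hcont : Continuous fun t => β t - α t := hβ.continuous.sub hα.continuous
  obtain ⟨t, -, ht⟩ := intermediate_value_uIcc (a := θ) (b := 0) hcont.continuousOn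
    (mem_uIcc.2 (Or.inl ⟨sub_nonpos.2 hle, (sub_pos.2 h0).le⟩))
  have := ODE_solution_unique_univ (v := truncatedField δ) (s := fun _ => univ) (t₀ := t)
    (fun t => (truncatedField_lipschitz hδ t).lipschitzOnWith) (fun t => ⟨hα t, trivial⟩)
    (fun t => ⟨hβ t, trivial⟩) (sub_eq_zero.1 ht).symm
  exact h0.ne (congrFun this 0)

theorem isIntegralCurve_zero (δ : ℝ) : IsIntegralCurve (fun _ => 0) (truncatedField δ) :=
  isIntegralCurve_const fun θ => by
    rw [truncatedField_eq ⟨le_rfl, by norm_num⟩]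
    simp [radialField]

/-- For `δ ∈ (0, 19991/100000)`, the Rychkov system `ẋ = y - (x⁵ - x³ + δx), ẏ = -x`
has at least two distinct (disjoint) nonconstant periodic solutions. -/
theorem rychkov_two_limit_cycles
    (δ : ℝ) (hδ0 : 0 < δ) (hδ1 : δ < 19991 / 100000) :
    ∃ (γ σ : ℝ → ℝ × ℝ) (T₁ T₂ : ℝ), 0 < T₁ ∧ 0 < T₂ ∧
      (∀ t : ℝ, HasDerivAt γ
        ((γ t).2 - ((γ t).1 ^ 5 - (γ t).1 ^ 3 + δ * (γ t).1), -(γ t).1) t) ∧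
      (∀ t : ℝ, HasDerivAt σ
        ((σ t).2 - ((σ t).1 ^ 5 - (σ t).1 ^ 3 + δ * (σ t).1), -(σ t).1) t) ∧
      (∀ t : ℝ, γ (t + T₁) = γ t) ∧ (∀ t : ℝ, σ (t + T₂) = σ t) ∧
      (∃ t₁ t₂ : ℝ, γ t₁ ≠ γ t₂) ∧ (∃ t₁ t₂ : ℝ, σ t₁ ≠ σ t₂) ∧
      Disjoint (Set.range γ) (Set.range σ) := by
  have hδ : δ ∈ Icc (0 : ℝ) (1 / 5) := ⟨hδ0.le, by linarith⟩
  set L : ℝ → ℝ := fun θ => (innerForm (Real.sin θ) (Real.cos θ))⁻¹ with hL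
  set U : ℝ → ℝ := fun θ => (outerForm (Real.sin θ) (Real.cos θ))⁻¹ with hU
  have hsub := inner_subsolution ⟨hδ0.le, hδ1.le⟩
  have hsup := outer_supersolution hδ
  have hL0 : L 0 = 100000 / 166205 := by simp [hL, innerForm]
  have hU0 : U 0 = 8 / 5 := by
    simp only [hU, outerForm, Real.sin_zero, Real.cos_zero]
    norm_num
  have hLmap : ∀ α, IsIntegralCurve α (truncatedField δ) → α 0 = L 0 → L 0 ≤ α Real.pi := by
    intro α hα h0
    have := hα.subsolution_le hasDerivAt_inv_innerForm hsub h0.ge Real.pi_pos.le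
    rwa [periodic_inv_innerForm.eq] at this
  have hUmap : ∀ α, IsIntegralCurve α (truncatedField δ) → α 0 = U 0 → α Real.pi ≤ U 0 := by
    intro α hα h0
    have := hα.le_supersolution hasDerivAt_inv_outerForm hsup h0.le Real.pi_pos.le
    rwa [periodic_inv_outerForm.eq] at this
  obtain ⟨α, hα, hαper, hα0⟩ := exists_periodic_isIntegralCurve (a := δ / 2) (b := L 0)
    (truncatedField_lipschitz hδ) (truncatedField_continuous hδ) (truncatedField_bound hδ)
    (truncatedField_periodic δ) Real.pi_pos.le (by rw [hL0]; linarith)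
    fun α β hα hβ hα0 hβ0 => mem_uIcc.2 (Or.inl
      ⟨sub_nonpos.2 (map_pi_le_of_small ⟨hδ0, hδ.2⟩ hα hα0), sub_nonneg.2 (hLmap β hβ hβ0)⟩)
  obtain ⟨β, hβ, hβper, hβ0⟩ := exists_periodic_isIntegralCurve (a := L 0) (b := U 0)
    (truncatedField_lipschitz hδ) (truncatedField_continuous hδ) (truncatedField_bound hδ)
    (truncatedField_periodic δ) Real.pi_pos.le (by rw [hL0, hU0]; norm_num)
    fun α β hα hβ hα0 hβ0 => mem_uIcc.2 (Or.inr
      ⟨sub_nonpos.2 (hUmap β hβ hβ0), sub_nonneg.2 (hLmap α hα hα0)⟩)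
  have hα0L : α 0 < L 0 := hα0.2.lt_of_ne fun h => absurd
    (hα.subsolution_lt hasDerivAt_inv_innerForm hsub h.ge hαper periodic_inv_innerForm
      Real.pi_pos 0) h.not_gt
  have hαβ : ∀ θ, α θ < β θ := truncatedField_order hδ hα hβ (hα0L.trans_le hβ0.1)
  have hαpos : ∀ θ, 0 < α θ := truncatedField_order hδ (isIntegralCurve_zero δ) hα
    (lt_of_lt_of_le (by linarith) hα0.1)
  have hβle : ∀ θ, β θ ≤ 48 / 25 := fun θ =>
    (hβper.le_of_forall_nonneg periodic_inv_outerForm Real.pi_pos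
      (fun s hs => hβ.le_supersolution hasDerivAt_inv_outerForm hsup hβ0.2 hs) θ).trans
      (inv_mem_of_ge (outerForm_ge (Real.sin_sq_add_cos_sq θ))).2
  have hαmem : ∀ θ, α θ ∈ Icc (0 : ℝ) (48 / 25) := fun θ =>
    ⟨(hαpos θ).le, (hαβ θ).le.trans (hβle θ)⟩
  have hβpos : ∀ θ, 0 < β θ := fun θ => (hαpos θ).trans (hαβ θ)
  have hβmem : ∀ θ, β θ ∈ Icc (0 : ℝ) (48 / 25) := fun θ => ⟨(hβpos θ).le, hβle θ⟩
  obtain ⟨γ, T₁, hT₁, hγ, hγT, hγne, hγpolar⟩ := exists_periodic_orbit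
    (fun θ => truncatedField_eq (δ := δ) (hαmem θ) ▸ hα θ) hαpos hαper
    fun θ => ⟨angularSpeed_pos hδ (hαmem θ), (angularSpeed_mem hδ (hαmem θ)).2⟩
  obtain ⟨σ, T₂, hT₂, hσ, hσT, hσne, hσpolar⟩ := exists_periodic_orbit
    (fun θ => truncatedField_eq (δ := δ) (hβmem θ) ▸ hβ θ) hβpos hβper
    fun θ => ⟨angularSpeed_pos hδ (hβmem θ), (angularSpeed_mem hδ (hβmem θ)).2⟩
  refine ⟨γ, σ, T₁, T₂, hT₁, hT₂, hγ, hσ, hγT, hσT, hγne, hσne, ?_⟩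
  rw [Set.disjoint_left]
  rintro _ ⟨t, rfl⟩ ⟨s, hs⟩
  obtain ⟨θ₁, hθ₁⟩ := hγpolar t
  obtain ⟨θ₂, hθ₂⟩ := hσpolar s
  exact polar_ne_of_lt hαpos hαβ hαper θ₁ θ₂ (by rw [← hθ₁, ← hθ₂, hs])
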